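/- arXiv:2410.18604 — 2 statements merged into one kernel-verified Lean document; each statement's English description precedes it below -/
import Mathlib

section
/- For every i ∈ I there exists a unique F-algebra endomorphism σ_i' of 𝒜 satisfying, for all m ∈ ℤ: σ_i'(E_{i,m}) = E_{i,m−1}K_{i,m−1}^{−1}; σ_i'(E_{j,m}) = (v^{1/2}E_{j,m}E_{i,m} − v^{−1/2}E_{i,m}E_{j,m})/(v − v^{−1}) whenever a_{ij} = −1; σ_i'(E_{j,m}) = E_{j,m} whenever a_{ij} = 0; σ_i'(K_{i,m}) = K_{i,m}^{−1}; σ_i'(K_{j,m}) = K_{i,m}K_{j,m} whenever a_{ij} = −1; and σ_i'(K_{j,m}) = K_{j,m} whenever a_{ij} = 0. -/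
/-!
Braid group action on the twisted semi-derived Hall algebra (Contu, arXiv:2410.18604).

We work with the algebra `𝒜 = 𝒮𝒟ℋ_tw(C^b(𝒫))` given by its presentation
(Proposition `prop_presenentation_semiderived_E_i` of the paper): generators
`E_{i,m}`, `K_{i,m}`, `K_{i,m}⁻¹` (`i ∈ I`, `m ∈ ℤ`) over `F = ℚ(v^{1/2})`,
subject to the relations (SD0)–(SD5).
-/

noncomputable section

namespace SDHall

/-- The field `ℚ(v^{1/2})` of rational functions over `ℚ` in one indeterminate `v^{1/2}`. -/
abbrev F₀ : Type := RatFunc ℚ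

/-- The indeterminate `v^{1/2}`. -/
def sq : F₀ := RatFunc.X

/-- `v := (v^{1/2})²`. -/
def v : F₀ := sq ^ 2

/-- The sign `(-1)^n` for an integer `n`. -/
def sgn (n : ℤ) : ℤ := (((-1 : ℤˣ) ^ n : ℤˣ) : ℤ)

/-- Generators `E_{i,m}`, `K_{i,m}`, `K_{i,m}⁻¹` of the presented algebra. -/
inductive Gen (I : Type) : Type
  | E : I → ℤ → Gen I
  | K : I → ℤ → Gen I
  | Kinv : I → ℤ → Gen I

variable {I : Type}

def e (i : I) (m : ℤ) : FreeAlgebra F₀ (Gen I) := FreeAlgebra.ι F₀ (Gen.E i m)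
def κ (i : I) (m : ℤ) : FreeAlgebra F₀ (Gen I) := FreeAlgebra.ι F₀ (Gen.K i m)
def κ' (i : I) (m : ℤ) : FreeAlgebra F₀ (Gen I) := FreeAlgebra.ι F₀ (Gen.Kinv i m)

/-- The defining relations (SD0)–(SD5) of the twisted semi-derived Hall algebra:
(SD0) `K_{i,m}K_{i,m}⁻¹ = 1 = K_{i,m}⁻¹K_{i,m}`;
(SD1) each `K_{i,m}` is central;
(SD2) `E_{i,m}E_{j,m} = E_{j,m}E_{i,m}` if `a_{ij} = 0`;
(SD3) `E_{i,m}²E_{j,m} − (v+v⁻¹)E_{i,m}E_{j,m}E_{i,m} + E_{j,m}E_{i,m}² = 0` if `a_{ij} = −1`;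
(SD4) `E_{i,m+1}E_{j,m} = v^{a_{ij}}E_{j,m}E_{i,m+1} + δ_{ij}(1−v²)K_{i,m}`
      (split into the cases `i ≠ j` and `i = j`);
(SD5) `E_{j,r}E_{i,l} = v^{−(−1)^{r−l}a_{ij}}E_{i,l}E_{j,r}` for `r > l+1`. -/
inductive Rel (a : I → I → ℤ) : FreeAlgebra F₀ (Gen I) → FreeAlgebra F₀ (Gen I) → Prop
  | sd0a (i : I) (m : ℤ) : Rel a (κ i m * κ' i m) 1
  | sd0b (i : I) (m : ℤ) : Rel a (κ' i m * κ i m) 1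
  | sd1 (i : I) (m : ℤ) (x : FreeAlgebra F₀ (Gen I)) : Rel a (κ i m * x) (x * κ i m)
  | sd2 (i j : I) (m : ℤ) : a i j = 0 → Rel a (e i m * e j m) (e j m * e i m)
  | sd3 (i j : I) (m : ℤ) : a i j = -1 →
      Rel a (e i m ^ 2 * e j m - (v + v⁻¹) • (e i m * e j m * e i m) + e j m * e i m ^ 2) 0
  | sd4_ne (i j : I) (m : ℤ) : i ≠ j →
      Rel a (e i (m + 1) * e j m) ((v ^ (a i j)) • (e j m * e i (m + 1)))
  | sd4_eq (i : I) (m : ℤ) :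
      Rel a (e i (m + 1) * e i m)
        ((v ^ (a i i)) • (e i m * e i (m + 1)) + ((1 : F₀) - v ^ 2) • κ i m)
  | sd5 (i j : I) (r l : ℤ) : r > l + 1 →
      Rel a (e j r * e i l) ((v ^ (-(sgn (r - l)) * a i j)) • (e i l * e j r))

/-- The twisted semi-derived Hall algebra `𝒜`, presented by generators and relations. -/
abbrev A (a : I → I → ℤ) : Type := RingQuot (Rel a)

/-- The generator `E_{i,m}` of `𝒜`. -/
def E (a : I → I → ℤ) (i : I) (m : ℤ) : A a := RingQuot.mkAlgHom F₀ (Rel a) (e i m)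

/-- The generator `K_{i,m}` of `𝒜`. -/
def K (a : I → I → ℤ) (i : I) (m : ℤ) : A a := RingQuot.mkAlgHom F₀ (Rel a) (κ i m)

/-- The generator `K_{i,m}⁻¹` of `𝒜`. -/
def Kinv (a : I → I → ℤ) (i : I) (m : ℤ) : A a := RingQuot.mkAlgHom F₀ (Rel a) (κ' i m)

/-- `a` is a simply-laced generalized Cartan matrix: symmetric, `a_{ii} = 2`,
and `a_{ij} ∈ {0, −1}` for `i ≠ j`. -/
def IsCartan (a : I → I → ℤ) : Prop :=
  (∀ i j, a i j = a j i) ∧ (∀ i, a i i = 2) ∧ ∀ i j, i ≠ j → a i j = 0 ∨ a i j = -1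

/-- The element `(v^{1/2}E_{i,m}E_{j,m} − v^{−1/2}E_{j,m}E_{i,m})/(v − v^{−1})` of `𝒜`. -/
def T (a : I → I → ℤ) (i j : I) (m : ℤ) : A a :=
  (v - v⁻¹)⁻¹ • (sq • (E a i m * E a j m) - sq⁻¹ • (E a j m * E a i m))

/-- The defining formulas for the braid group operator `σᵢ` on the generators:
`σᵢ(E_{i,m}) = E_{i,m+1}K_{i,m}⁻¹`;
`σᵢ(E_{j,m}) = (v^{1/2}E_{i,m}E_{j,m} − v^{−1/2}E_{j,m}E_{i,m})/(v − v^{−1})` if `a_{ij} = −1`;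
`σᵢ(E_{j,m}) = E_{j,m}` if `a_{ij} = 0`;
`σᵢ(K_{i,m}) = K_{i,m}⁻¹`; `σᵢ(K_{j,m}) = K_{i,m}K_{j,m}` if `a_{ij} = −1`;
`σᵢ(K_{j,m}) = K_{j,m}` if `a_{ij} = 0`. -/
def SigmaSpec (a : I → I → ℤ) (i : I) (σ : A a →ₐ[F₀] A a) : Prop :=
  (∀ m : ℤ, σ (E a i m) = E a i (m + 1) * Kinv a i m) ∧
  (∀ (j : I) (m : ℤ), a i j = -1 → σ (E a j m) = T a i j m) ∧
  (∀ (j : I) (m : ℤ), a i j = 0 → σ (E a j m) = E a j m) ∧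
  (∀ m : ℤ, σ (K a i m) = Kinv a i m) ∧
  (∀ (j : I) (m : ℤ), a i j = -1 → σ (K a j m) = K a i m * K a j m) ∧
  (∀ (j : I) (m : ℤ), a i j = 0 → σ (K a j m) = K a j m)

/-- The defining formulas for the inverse operator `σᵢ'` on the generators:
`σᵢ'(E_{i,m}) = E_{i,m−1}K_{i,m−1}⁻¹`;
`σᵢ'(E_{j,m}) = (v^{1/2}E_{j,m}E_{i,m} − v^{−1/2}E_{i,m}E_{j,m})/(v − v^{−1})` if `a_{ij} = −1`;
`σᵢ'(E_{j,m}) = E_{j,m}` if `a_{ij} = 0`;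
`σᵢ'(K_{i,m}) = K_{i,m}⁻¹`; `σᵢ'(K_{j,m}) = K_{i,m}K_{j,m}` if `a_{ij} = −1`;
`σᵢ'(K_{j,m}) = K_{j,m}` if `a_{ij} = 0`. -/
def SigmaSpec' (a : I → I → ℤ) (i : I) (σ : A a →ₐ[F₀] A a) : Prop :=
  (∀ m : ℤ, σ (E a i m) = E a i (m - 1) * Kinv a i (m - 1)) ∧
  (∀ (j : I) (m : ℤ), a i j = -1 → σ (E a j m) = T a j i m) ∧
  (∀ (j : I) (m : ℤ), a i j = 0 → σ (E a j m) = E a j m) ∧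
  (∀ m : ℤ, σ (K a i m) = Kinv a i m) ∧
  (∀ (j : I) (m : ℤ), a i j = -1 → σ (K a j m) = K a i m * K a j m) ∧
  (∀ (j : I) (m : ℤ), a i j = 0 → σ (K a j m) = K a j m)

end SDHall

open SDHall

set_option linter.unusedSimpArgs false

namespace SDAux

section Abstract

variable {F R : Type} [Field F] [Ring R] [Algebra F R]

/-- Quantum Serre relation with cleared denominators. -/
def PSer (v : F) (a b : R) : Prop :=
  v • (a * a * b) - (v ^ 2 + 1) • (a * b * a) + v • (b * a * a) = 0

/-- The unnormalised image of a neighbouring generator. -/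
def Yel (v : F) (y x : R) : R := v • (y * x) - x * y

theorem yel_comm (v : F) (hv : v ^ 2 + 1 ≠ 0) (x y z : R) (hxy : PSer v x y) (hxz : PSer v x z)
    (hc : y * z = z * y) : Yel v y x * Yel v z x = Yel v z x * Yel v y x := by
  unfold PSer at hxy hxz
  unfold Yel
  rw [← sub_eq_zero]
  refine (smul_eq_zero_iff_right hv).1 ?_
  linear_combination (norm := skip) (- v^2 : F) • (y * hxz) +
    (v : F) • (x * x * hc) +
    (- v - v^3 : F) • (x * hc * x) +
    (1 : F) • (hxz * y) +
    (- 1 : F) • (hxy * z) +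
    (v^3 : F) • (hc * x * x) +
    (v^2 : F) • (z * hxy)
  simp only [mul_add, add_mul, mul_sub, sub_mul, smul_mul_assoc, mul_smul_comm, mul_assoc,
    mul_zero, zero_mul]
  module

theorem yel_serre_far (v : F) (hv : v ^ 2 + 1 ≠ 0) (x y z : R) (hxy : PSer v x y)
    (hyz : PSer v y z)
    (hc : x * z = z * x) : PSer v (Yel v y x) z := by
  unfold PSer at *
  unfold Yel
  refine (smul_eq_zero_iff_right hv).1 ?_
  linear_combination (norm := skip) (v : F) • (x * x * hyz) +
    (- v - v^3 : F) • (x * hyz * x) +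
    (- v : F) • (hxy * y * z) +
    (- v^2 : F) • (hc * x * y * y) +
    (- v^2 - 2 * v^4 - v^6 : F) • (y * hc * y * x) +
    (- v^2 - v^4 : F) • (x * y * y * hc) +
    (- v^3 : F) • (z * y * hxy) +
    (v^4 : F) • (y * y * x * hc) +
    (- v : F) • (z * hxy * y) +
    (1 + v^2 : F) • (hxy * z * y) +
    (v^3 : F) • (hyz * x * x) +
    (- v - v^3 : F) • (y * x * hc * y) +
    (v^4 : F) • (y * y * hc * x) +
    (- v^2 : F) • (x * hc * y * y) +
    (v^2 + v^4 : F) • (y * z * hxy) +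
    (- v^3 : F) • (y * hxy * z) +
    (v^3 + v^5 : F) • (y * hc * x * y) +
    (v^2 + v^4 : F) • (hc * y * y * x) +
    (1 + 2 * v^2 + v^4 : F) • (x * y * hc * y)
  simp only [mul_add, add_mul, mul_sub, sub_mul, smul_mul_assoc, mul_smul_comm, mul_assoc,
    mul_zero, zero_mul]
  module

theorem yel_serre_near (v : F) (hv : (v ^ 2 + 1) * (v ^ 4 + v ^ 2 + 1) ≠ 0) (x y z : R)
    (hxy : PSer v x y) (hxz : PSer v x z)
    (hyz : PSer v y z) : PSer v (Yel v y x) (Yel v z x) := by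
  unfold PSer at *
  unfold Yel
  refine (smul_eq_zero_iff_right hv).1 ?_
  linear_combination (norm := skip) (v^2 + v^4 + v^6 : F) • (x * x * hyz * x) +
    (- v^2 - v^4 : F) • (z * x * hxy * y) +
    (v + 2 * v^3 + 2 * v^5 + v^7 : F) • (hxy * z * y * x) +
    (v^3 + v^5 + v^7 : F) • (x * z * y * hxy) +
    (- v^5 - v^7 : F) • (z * y * x * hxy) +
    (- v^2 - v^4 - v^6 : F) • (hxy * y * z * x) +
    (v^4 + 2 * v^6 + v^8 : F) • (y * z * x * hxy) +
    (v^5 + v^7 : F) • (y * hxy * x * z) +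
    (v^2 + v^4 : F) • (hxz * x * y * y) +
    (v^5 + v^7 : F) • (z * hxy * x * y) +
    (- v^6 : F) • (y * y * hxz * x) +
    (- v^3 - v^5 - v^7 : F) • (x * hyz * x * x) +
    (v + 2 * v^3 + v^5 : F) • (y * x * hxz * y) +
    (v^5 + v^7 : F) • (y * z * hxy * x) +
    (- v^6 : F) • (z * y * hxy * x) +
    (v^3 + 2 * v^5 + 2 * v^7 + v^9 : F) • (y * hxz * y * x) +
    (- 1 - 2 * v^2 - 2 * v^4 - v^6 : F) • (x * y * hxz * y) +
    (v + v^3 + v^5 : F) • (x * y * hxy * z) +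
    (- v^2 - v^4 - v^6 : F) • (hxz * y * y * x) +
    (v + v^3 + v^5 : F) • (x * z * hxy * y) +
    (- v^4 - 2 * v^6 - v^8 : F) • (y * hxz * x * y) +
    (- v^4 - v^6 - v^8 : F) • (z * hxy * y * x) +
    (- v^2 - v^4 : F) • (y * x * hxy * z) +
    (v^3 + v^5 + v^7 : F) • (x * y * y * hxz) +
    (- v^4 - v^6 - v^8 : F) • (y * hxy * z * x) +
    (- v^2 - 2 * v^4 - 2 * v^6 - v^8 : F) • (x * y * z * hxy) +
    (- v^5 - v^7 : F) • (y * y * x * hxz) +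
    (- v^2 - v^4 : F) • (x * hxy * z * y) +
    (v^3 : F) • (x * hxy * y * z) +
    (v^2 + v^4 : F) • (hxy * x * y * z) +
    (v^6 : F) • (hyz * x * x * x) +
    (v^3 : F) • (x * hxz * y * y) +
    (- v - 2 * v^3 - v^5 : F) • (hxy * x * z * y) +
    (- v^3 : F) • (x * x * x * hyz)
  simp only [mul_add, add_mul, mul_sub, sub_mul, smul_mul_assoc, mul_smul_comm, mul_assoc,
    mul_zero, zero_mul]
  module

/-- `a` and `b` commute up to the power `v ^ n`. -/
def QC (v : F) (n : ℤ) (a b : R) : Prop := a * b = v ^ n • (b * a)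

theorem QC.mul_left {v : F} (hv : v ≠ 0) {n p : ℤ} {a b t : R} (h : QC v n a t) (g : QC v p b t) :
    QC v (n + p) (a * b) t := by
  unfold QC at *
  rw [mul_assoc, g, mul_smul_comm, ← mul_assoc, h, smul_mul_assoc, smul_smul, mul_assoc,
    zpow_add₀ hv, mul_comm]

theorem QC.mul_right {v : F} (hv : v ≠ 0) {n p : ℤ} {a b t : R} (h : QC v n t a) (g : QC v p t b) :
    QC v (n + p) t (a * b) := by
  unfold QC at *
  rw [← mul_assoc, h, smul_mul_assoc, mul_assoc, g, mul_smul_comm, smul_smul, mul_assoc,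
    zpow_add₀ hv]

theorem QC.yel_left {v : F} (hv : v ≠ 0) {n p : ℤ} {a b t : R} (h : QC v n a t) (g : QC v p b t) :
    QC v (n + p) (Yel v a b) t := by
  have h1 := h.mul_left hv g
  have h2 := g.mul_left hv h
  rw [add_comm] at h2
  unfold QC Yel at *
  rw [sub_mul, smul_mul_assoc, h1, h2, mul_sub, mul_smul_comm]
  module

theorem QC.yel_right {v : F} (hv : v ≠ 0) {n p : ℤ} {a b t : R} (h : QC v n t a) (g : QC v p t b) :
    QC v (n + p) t (Yel v a b) := by
  have h1 := h.mul_right hv g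
  have h2 := g.mul_right hv h
  rw [add_comm] at h2
  unfold QC Yel at *
  rw [sub_mul, smul_mul_assoc, mul_sub, mul_smul_comm, h1, h2]
  module

theorem QC.smul_left {v : F} {n : ℤ} {a t : R} (c : F) (h : QC v n a t) : QC v n (c • a) t := by
  unfold QC at *
  rw [smul_mul_assoc, h, mul_smul_comm, smul_comm]

theorem QC.smul_right {v : F} {n : ℤ} {a t : R} (c : F) (h : QC v n t a) : QC v n t (c • a) := by
  unfold QC at *
  rw [mul_smul_comm, h, smul_mul_assoc, smul_comm]

theorem QC.central_left {v : F} {n : ℤ} {a t k : R} (hk : ∀ s, k * s = s * k) (h : QC v n a t) :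
    QC v n (a * k) t := by
  unfold QC at *
  rw [mul_assoc, hk, ← mul_assoc, h, smul_mul_assoc, mul_assoc]

theorem QC.central_right {v : F} {n : ℤ} {a t k : R} (hk : ∀ s, k * s = s * k) (h : QC v n t a) :
    QC v n t (a * k) := by
  unfold QC at *
  rw [← mul_assoc, h, smul_mul_assoc, mul_assoc, mul_assoc, hk t]

theorem QC.symm0 {v : F} {a b : R} (h : QC v 0 a b) : QC v 0 b a := by
  simp only [QC, zpow_zero, one_smul] at *
  exact h.symm

theorem PSer.smul {v : F} {a b : R} (c d : F) (h : PSer v a b) : PSer v (c • a) (d • b) := by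
  unfold PSer at *
  linear_combination (norm := skip) (c * c * d) • h
  simp only [smul_mul_assoc, mul_smul_comm, mul_assoc]
  module

theorem PSer.central_left {v : F} {a b k : R} (hk : ∀ s, k * s = s * k) (h : PSer v a b) :
    PSer v (a * k) b := by
  unfold PSer at *
  have e1 : a * k * (a * k) * b = a * a * b * (k * k) := by
    simp only [mul_assoc, hk]
  have e2 : a * k * b * (a * k) = a * b * a * (k * k) := by
    simp only [mul_assoc, hk]
  have e3 : b * (a * k) * (a * k) = b * a * a * (k * k) := by
    simp only [mul_assoc, hk]
  rw [e1, e2, e3]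
  linear_combination (norm := skip) h * (k * k)
  simp only [add_mul, sub_mul, smul_mul_assoc, zero_mul]
  module

theorem PSer.central_right {v : F} {a b k : R} (hk : ∀ s, k * s = s * k) (h : PSer v a b) :
    PSer v a (b * k) := by
  unfold PSer at *
  have e1 : a * a * (b * k) = a * a * b * k := by
    simp only [mul_assoc]
  have e2 : a * (b * k) * a = a * b * a * k := by
    simp only [mul_assoc, hk]
  have e3 : b * k * a * a = b * a * a * k := by
    simp only [mul_assoc, hk]
  rw [e1, e2, e3]
  linear_combination (norm := skip) h * k
  simp only [add_mul, sub_mul, smul_mul_assoc, zero_mul]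
  module

theorem yel_serre_far' (v : F) (x y z : R) (hzy : PSer v z y) (hc : x * z = z * x) :
    PSer v z (Yel v y x) := by
  unfold PSer at *
  unfold Yel
  linear_combination (norm := skip) v • (hzy * x) - x * hzy
    + (v * v) • (y * hc * z) + (v * v) • (y * z * hc) - (v * (v ^ 2 + 1)) • (z * y * hc)
    + v • (hc * z * y) + v • (z * hc * y) - (v ^ 2 + 1) • (hc * y * z)
  simp only [mul_add, add_mul, mul_sub, sub_mul, smul_mul_assoc, mul_smul_comm, mul_assoc,
    mul_zero, zero_mul]
  module

/-- `x Y = v⁻¹ Y x`. -/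
theorem x_yel {v : F} (hv : v ≠ 0) {x y : R} (h : PSer v x y) : QC v (-1) x (Yel v y x) := by
  unfold PSer QC Yel at *
  refine (smul_right_injective R hv) ?_
  simp only [zpow_neg, zpow_one, smul_smul, mul_inv_cancel₀ hv, one_smul]
  linear_combination (norm := skip) (-1 : F) • h
  simp only [mul_add, add_mul, mul_sub, sub_mul, smul_mul_assoc, mul_smul_comm, mul_assoc,
    mul_zero, zero_mul]
  module

/-- `y Y = v Y y`. -/
theorem y_yel {v : F} {x y : R} (h : PSer v y x) : y * (Yel v y x) = v • (Yel v y x * y) := by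
  unfold PSer Yel at *
  linear_combination (norm := skip) h
  simp only [mul_add, add_mul, mul_sub, sub_mul, smul_mul_assoc, mul_smul_comm, mul_assoc,
    mul_zero, zero_mul]
  module

/-- `x' Y = v Y x'` where `x'` is one level up. -/
theorem xup_yel {v : F} (hv : v ≠ 0) {x x' y k : R} (hk : ∀ s, k * s = s * k)
    (h1 : x' * x = (v ^ 2) • (x * x') + (1 - v ^ 2) • k) (h2 : QC v (-1) x' y) :
    QC v 1 x' (Yel v y x) := by
  unfold QC Yel at *
  rw [zpow_neg, zpow_one] at h2
  rw [zpow_one]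
  have hky := hk y
  linear_combination (norm := skip) v • (h2 * x) - h1 * y - x * (v ^ 2) • h2 + y * h1
    - (1 - v ^ 2) • hky
  simp only [mul_add, add_mul, mul_sub, sub_mul, smul_mul_assoc, mul_smul_comm, mul_assoc,
    mul_zero, zero_mul, smul_add, smul_sub]
  match_scalars <;> field_simp <;> ring

/-- `y' Y` where `y'` is one level up. -/
theorem yup_yel {v : F} (hv : v ≠ 0) (w : F) {x y' z K : R} (hK : ∀ s, K * s = s * K)
    (h3 : QC v (-1) y' x) (h4 : y' * z = w • (z * y') + K) :
    y' * Yel v z x = (w * v⁻¹) • (Yel v z x * y') + (v - v⁻¹) • (K * x) := by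
  unfold QC Yel at *
  rw [zpow_neg, zpow_one] at h3
  have hKx := hK x
  linear_combination (norm := skip) v • (h4 * x) + (v * w) • (z * h3) - h3 * z - v⁻¹ • (x * h4)
    + v⁻¹ • hKx
  simp only [mul_add, add_mul, mul_sub, sub_mul, smul_mul_assoc, mul_smul_comm, mul_assoc,
    mul_zero, zero_mul, smul_add, smul_sub]
  match_scalars <;> field_simp <;> ring

/-- `Y' Y` for neighbouring vertices in adjacent levels. -/
theorem yelup_yel {v : F} (hv : v ≠ 0) (w : F) {x x' y' z k K : R} (hk : ∀ s, k * s = s * k)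
    (hK : ∀ s, K * s = s * K)
    (h1 : x' * x = (v ^ 2) • (x * x') + (1 - v ^ 2) • k) (h2 : QC v (-1) x' z)
    (h3 : QC v (-1) y' x) (h4 : y' * z = w • (z * y') + K) :
    Yel v y' x' * Yel v z x = w • (Yel v z x * Yel v y' x') +
      ((v - v⁻¹) * (v ^ 2 - 1)) • (K * k) := by
  have a1 := xup_yel hv hk h1 h2
  have a2 := yup_yel hv w hK h3 h4
  have hKx := hK x'
  unfold QC at a1
  rw [zpow_one] at a1
  generalize Yel v z x = Y at *
  unfold Yel
  linear_combination (norm := skip) v • (y' * a1) - x' * a2 + (v * v) • (a2 * x')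
    - (w * v⁻¹) • (a1 * y') + (v - v⁻¹) • (hKx * x) - (v - v⁻¹) • (K * h1)
  simp only [mul_add, add_mul, mul_sub, sub_mul, smul_mul_assoc, mul_smul_comm, mul_assoc,
    mul_zero, zero_mul, smul_add, smul_sub]
  match_scalars <;> field_simp <;> ring

/-- `Y x'` where now `x'` is one level down. -/
theorem yel_xdown {v : F} (hv : v ≠ 0) {x x' y k : R} (hk : ∀ s, k * s = s * k)
    (h1 : x * x' = (v ^ 2) • (x' * x) + (1 - v ^ 2) • k) (h2 : QC v (-1) y x') :
    Yel v y x * x' = v • (x' * Yel v y x) + ((1 - v ^ 2) * (v - v⁻¹)) • (k * y) := by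
  unfold QC Yel at *
  rw [zpow_neg, zpow_one] at h2
  have hky := hk y
  linear_combination (norm := skip) v • (y * h1) - x * h2 - v⁻¹ • (h1 * y) + (v * v ^ 2) • (h2 * x)
    - (v * (1 - v ^ 2)) • hky
  simp only [mul_add, add_mul, mul_sub, sub_mul, smul_mul_assoc, mul_smul_comm, mul_assoc,
    mul_zero, zero_mul, smul_add, smul_sub]
  match_scalars <;> field_simp <;> ring

theorem serre_xdown_yel {v : F} (hv : v ≠ 0) {x x' y k : R} (hk : ∀ s, k * s = s * k)
    (h1 : x * x' = (v ^ 2) • (x' * x) + (1 - v ^ 2) • k) (h2 : QC v (-1) y x') :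
    PSer v x' (Yel v y x) := by
  have a1 := yel_xdown hv hk h1 h2
  unfold QC at h2
  rw [zpow_neg, zpow_one] at h2
  have hkx := hk x'
  unfold PSer
  generalize Yel v y x = Y at *
  linear_combination (norm := skip) v • (a1 * x') - x' * a1
    + (v * ((1 - v ^ 2) * (v - v⁻¹))) • (k * h2)
    + ((1 - v ^ 2) * (v - v⁻¹)) • (hkx * y)
  simp only [mul_add, add_mul, mul_sub, sub_mul, smul_mul_assoc, mul_smul_comm, mul_assoc,
    mul_zero, zero_mul, smul_add, smul_sub]
  match_scalars <;> field_simp <;> ring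

theorem serre_yel_xdown {v : F} (hv : v ≠ 0) {x x' y k : R} (hk : ∀ s, k * s = s * k)
    (h1 : x * x' = (v ^ 2) • (x' * x) + (1 - v ^ 2) • k) (h2 : QC v (-1) y x')
    (hyx : PSer v y x) :
    PSer v (Yel v y x) x' := by
  have a1 := yel_xdown hv hk h1 h2
  have a2 := y_yel hyx
  unfold PSer
  generalize Yel v y x = Y at *
  have hkY := hk Y
  linear_combination (norm := skip) v • (Y * a1) - a1 * Y
    - ((1 - v ^ 2) * (v - v⁻¹)) • (k * a2)
    - (v * ((1 - v ^ 2) * (v - v⁻¹))) • (hkY * y)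
  simp only [mul_add, add_mul, mul_sub, sub_mul, smul_mul_assoc, mul_smul_comm, mul_assoc,
    mul_zero, zero_mul, smul_add, smul_sub]
  match_scalars <;> field_simp <;> ring

theorem pser_of {v : F} (hv : v ≠ 0) {x y : R}
    (h : x ^ 2 * y - (v + v⁻¹) • (x * y * x) + y * x ^ 2 = 0) : PSer v x y := by
  unfold PSer
  linear_combination (norm := skip) v • h
  simp only [pow_two, mul_assoc]
  match_scalars <;> field_simp <;> ring

theorem of_pser {v : F} (hv : v ≠ 0) {x y : R} (h : PSer v x y) :
    x ^ 2 * y - (v + v⁻¹) • (x * y * x) + y * x ^ 2 = 0 := by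
  unfold PSer at h
  linear_combination (norm := skip) (v⁻¹ : F) • h
  simp only [pow_two, mul_assoc]
  match_scalars <;> field_simp <;> ring

theorem yel_scale (c d q v : F) (hq : q = d * v) (x y : R) :
    c • (q • (y * x) - d • (x * y)) = (c * d) • Yel v y x := by
  subst hq
  unfold Yel
  module

theorem scale_up (c d w u : F) (hc : c * c * d = 1) (P Q : R) :
    c • c • (w • P + d • u • Q) = w • c • c • P + u • Q := by
  match_scalars
  · ring
  · linear_combination u * hc

end Abstract

section Concrete

variable {I : Type} {a : I → I → ℤ}

theorem sq_ne : (SDHall.sq : F₀) ≠ 0 := RatFunc.X_ne_zero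

theorem v_ne : (v : F₀) ≠ 0 := pow_ne_zero _ sq_ne

theorem poly_ne (p : Polynomial ℚ) (hp : p.eval 2 ≠ 0) :
    algebraMap (Polynomial ℚ) F₀ p ≠ 0 := by
  intro h
  rw [map_eq_zero_iff _ (IsFractionRing.injective (Polynomial ℚ) F₀)] at h
  rw [h] at hp
  simp at hp

theorem v_ne1 : (v : F₀) ^ 2 + 1 ≠ 0 := by
  have := poly_ne (Polynomial.X ^ 4 + 1) (by norm_num)
  rw [map_add, map_pow, RatFunc.algebraMap_X, map_one] at this
  unfold v SDHall.sq
  rw [← pow_mul]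
  exact this

theorem v_ne2 : (v : F₀) ^ 4 + v ^ 2 + 1 ≠ 0 := by
  have := poly_ne (Polynomial.X ^ 8 + Polynomial.X ^ 4 + 1) (by norm_num)
  rw [map_add, map_add, map_pow, map_pow, RatFunc.algebraMap_X, map_one] at this
  unfold v SDHall.sq
  rw [← pow_mul, ← pow_mul]
  exact this

theorem v_ne3 : (v : F₀) ^ 2 - 1 ≠ 0 := by
  have := poly_ne (Polynomial.X ^ 4 - 1) (by norm_num)
  rw [map_sub, map_pow, RatFunc.algebraMap_X, map_one] at this
  unfold v SDHall.sq
  rw [← pow_mul]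
  exact this

theorem v_ne4 : (v : F₀) - v⁻¹ ≠ 0 := by
  intro h
  apply v_ne3
  have : (v : F₀) ^ 2 - 1 = v * (v - v⁻¹) := by
    have := v_ne
    field_simp
  rw [this, h, mul_zero]

theorem sgn_succ (n : ℤ) : sgn (n + 1) = - sgn n := by
  simp [sgn, zpow_add]

theorem sgn_one : sgn 1 = -1 := by simp [sgn]

theorem sgn_two : sgn 2 = 1 := by
  rw [show (2 : ℤ) = 1 + 1 by norm_num, sgn_succ, sgn_one]; norm_num

theorem K_Kinv (i : I) (m : ℤ) : K a i m * Kinv a i m = 1 := by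
  have := RingQuot.mkAlgHom_rel F₀ (Rel.sd0a (a := a) i m)
  simpa [K, Kinv] using this

theorem Kinv_K (i : I) (m : ℤ) : Kinv a i m * K a i m = 1 := by
  have := RingQuot.mkAlgHom_rel F₀ (Rel.sd0b (a := a) i m)
  simpa [K, Kinv] using this

theorem K_comm (i : I) (m : ℤ) (x : A a) : K a i m * x = x * K a i m := by
  obtain ⟨y, rfl⟩ := RingQuot.mkAlgHom_surjective F₀ (Rel a) x
  have := RingQuot.mkAlgHom_rel F₀ (Rel.sd1 (a := a) i m y)
  simpa [K] using this

theorem Kinv_comm (i : I) (m : ℤ) (x : A a) : Kinv a i m * x = x * Kinv a i m := by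
  calc Kinv a i m * x = Kinv a i m * (x * K a i m) * Kinv a i m := by
        rw [mul_assoc, mul_assoc, K_Kinv, mul_one]
    _ = x * Kinv a i m := by
        rw [← K_comm, ← mul_assoc, Kinv_K, one_mul]

theorem E_comm (i j : I) (m : ℤ) (h : a i j = 0) : E a i m * E a j m = E a j m * E a i m := by
  have := RingQuot.mkAlgHom_rel F₀ (Rel.sd2 (a := a) i j m h)
  simpa [E] using this

theorem E_pser (i j : I) (m : ℤ) (h : a i j = -1) : PSer v (E a i m) (E a j m) := by
  have := RingQuot.mkAlgHom_rel F₀ (Rel.sd3 (a := a) i j m h)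
  apply pser_of v_ne
  simpa [E] using this

theorem E_qc (hA : IsCartan a) (i j : I) (r l : ℤ) (h : r > l) (h' : i ≠ j ∨ r ≠ l + 1) :
    QC v (-(sgn (r - l)) * a i j) (E a j r) (E a i l) := by
  by_cases hr : r = l + 1
  · subst hr
    have hij : j ≠ i := by
      rcases h' with h' | h'
      · exact h'.symm
      · exact absurd rfl h'
    have := RingQuot.mkAlgHom_rel F₀ (Rel.sd4_ne (a := a) j i l hij)
    unfold QC
    rw [show l + 1 - l = 1 by ring, sgn_one, hA.1 i j]
    simpa [E] using this
  · have := RingQuot.mkAlgHom_rel F₀ (Rel.sd5 (a := a) i j r l (by omega))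
    unfold QC
    simpa only [E, map_mul, map_smul] using this

theorem E_up (hA : IsCartan a) (i : I) (m : ℤ) :
    E a i (m + 1) * E a i m = (v ^ 2) • (E a i m * E a i (m + 1)) + (1 - v ^ 2) • K a i m := by
  have := RingQuot.mkAlgHom_rel F₀ (Rel.sd4_eq (a := a) i m)
  rw [hA.2.1 i, zpow_ofNat] at this
  simpa only [E, K, map_mul, map_add, map_smul] using this

theorem T_eq (i j : I) (m : ℤ) :
    T a j i m = ((v - v⁻¹)⁻¹ * SDHall.sq⁻¹) • Yel v (E a j m) (E a i m) := by
  have h : SDHall.sq = SDHall.sq⁻¹ * (v : F₀) := by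
    have := sq_ne
    unfold v
    field_simp
  exact yel_scale _ _ _ _ h _ _

open Classical in
/-- Image of `E_{j,m}`. -/
def imE (a : I → I → ℤ) (i j : I) (m : ℤ) : A a :=
  if j = i then E a i (m - 1) * Kinv a i (m - 1) else if a i j = -1 then T a j i m else E a j m

open Classical in
/-- Image of `K_{j,m}`. -/
def imK (a : I → I → ℤ) (i j : I) (m : ℤ) : A a :=
  if j = i then Kinv a i m else if a i j = -1 then K a i m * K a j m else K a j m

open Classical in
/-- Image of the inverse of `K_{j,m}`. -/
def imKinv (a : I → I → ℤ) (i j : I) (m : ℤ) : A a :=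
  if j = i then K a i m else if a i j = -1 then Kinv a i m * Kinv a j m else Kinv a j m

theorem imE_self (i : I) (m : ℤ) : imE a i i m = E a i (m - 1) * Kinv a i (m - 1) := by
  simp [imE]

theorem nbr_ne (hA : IsCartan a) {i j : I} (h : a i j = -1) : j ≠ i := by
  rintro rfl
  rw [hA.2.1] at h
  omega

theorem far_ne (hA : IsCartan a) {i j : I} (h : a i j = 0) : j ≠ i := by
  rintro rfl
  rw [hA.2.1] at h
  omega

theorem imE_nbr (hA : IsCartan a) (i j : I) (m : ℤ) (h : a i j = -1) :
    imE a i j m = ((v - v⁻¹)⁻¹ * SDHall.sq⁻¹) • Yel v (E a j m) (E a i m) := by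
  simp [imE, h, nbr_ne hA h, T_eq]

theorem imE_far (hA : IsCartan a) (i j : I) (m : ℤ) (h : a i j = 0) :
    imE a i j m = E a j m := by
  simp [imE, h, far_ne hA h]

theorem imK_self (i : I) (m : ℤ) : imK a i i m = Kinv a i m := by
  simp [imK]

theorem imK_nbr (hA : IsCartan a) (i j : I) (m : ℤ) (h : a i j = -1) :
    imK a i j m = K a i m * K a j m := by
  simp [imK, h, nbr_ne hA h]

theorem imK_far (hA : IsCartan a) (i j : I) (m : ℤ) (h : a i j = 0) :
    imK a i j m = K a j m := by
  simp [imK, h, far_ne hA h]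

theorem tri (hA : IsCartan a) (i j : I) : j = i ∨ a i j = -1 ∨ a i j = 0 := by
  by_cases h : j = i
  · exact Or.inl h
  · rcases hA.2.2 i j (Ne.symm h) with h | h
    · exact Or.inr (Or.inr h)
    · exact Or.inr (Or.inl h)

theorem imK_comm (i j : I) (m : ℤ) (x : A a) : imK a i j m * x = x * imK a i j m := by
  unfold imK
  split_ifs
  · exact Kinv_comm _ _ _
  · rw [mul_assoc, K_comm j, ← mul_assoc, K_comm i, mul_assoc]
  · exact K_comm _ _ _

theorem imK_imKinv (i j : I) (m : ℤ) : imK a i j m * imKinv a i j m = 1 := by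
  unfold imK imKinv
  split_ifs
  · exact Kinv_K _ _
  · rw [mul_assoc, Kinv_comm i, ← mul_assoc (K a j m), K_Kinv, one_mul, K_Kinv]
  · exact K_Kinv _ _

theorem imKinv_imK (i j : I) (m : ℤ) : imKinv a i j m * imK a i j m = 1 := by
  rw [← imK_comm, imK_imKinv]

theorem qc_comm {x y : A a} (h : x * y = y * x) : QC v 0 x y := by
  simpa [QC] using h

theorem comm_qc {x y : A a} (h : QC v 0 x y) : x * y = y * x := by
  simpa [QC] using h

theorem QC.cast {x y : A a} {n p : ℤ} (h : QC v n x y) (e : n = p) : QC v p x y := e ▸ h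

theorem im_sd2 (hA : IsCartan a) (i j k : I) (m : ℤ) (h : a j k = 0) :
    imE a i j m * imE a i k m = imE a i k m * imE a i j m := by
  have key : ∀ k, a i k = 0 → QC v 0 (imE a i i m) (imE a i k m) := by
    intro k hk
    rw [imE_self, imE_far hA i k m hk]
    refine QC.central_left (Kinv_comm _ _) (QC.symm0 ?_)
    refine (E_qc hA i k m (m - 1) (by omega) (Or.inl (far_ne hA hk).symm)).cast ?_
    rw [hk, mul_zero]
  have key2 : ∀ j k, a j k = 0 → a i j = -1 → a i k = 0 → QC v 0 (imE a i j m) (imE a i k m) := by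
    intro j k h hj hk
    rw [imE_nbr hA i j m hj, imE_far hA i k m hk]
    exact ((QC.yel_left v_ne (qc_comm (E_comm j k m h)) (qc_comm (E_comm i k m hk))).smul_left
      _).cast (by norm_num)
  have h' : a k j = 0 := by rw [hA.1, h]
  rcases tri hA i j with hj | hj | hj <;> rcases tri hA i k with hk | hk | hk
  · subst hj
    subst hk; rfl
  · subst hj
    rw [h] at hk; omega
  · subst hj
    exact comm_qc (key k hk)
  · subst hk; omega
  · rw [imE_nbr hA i j m hj, imE_nbr hA i k m hk]
    have := yel_comm v v_ne1 _ _ _ (E_pser i j m hj) (E_pser i k m hk) (E_comm j k m h)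
    simp only [smul_mul_assoc, mul_smul_comm, this]
  · exact comm_qc (key2 j k h hj hk)
  · subst hk; exact (comm_qc (key j hj)).symm
  · exact (comm_qc (key2 k j h' hk hj)).symm
  · rw [imE_far hA i j m hj, imE_far hA i k m hk]
    exact E_comm j k m h

theorem im_sd3 (hA : IsCartan a) (i j k : I) (m : ℤ) (h : a j k = -1) :
    PSer v (imE a i j m) (imE a i k m) := by
  have h' : a k j = -1 := by rw [hA.1, h]
  have up : E a i m * E a i (m - 1) = (v ^ 2) • (E a i (m - 1) * E a i m) +
      (1 - v ^ 2) • K a i (m - 1) := by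
    have := E_up hA i (m - 1)
    rwa [sub_add_cancel] at this
  have dn : ∀ k, a i k = -1 → QC v (-1) (E a k m) (E a i (m - 1)) := by
    intro k hk
    refine (E_qc hA i k m (m - 1) (by omega) (Or.inl (nbr_ne hA hk).symm)).cast ?_
    rw [hk, show m - (m - 1) = 1 by ring, sgn_one]; norm_num
  rcases tri hA i j with hj | hj | hj <;> rcases tri hA i k with hk | hk | hk
  · subst hj
    subst hk; exact absurd rfl (nbr_ne hA h)
  · subst hj
    rw [imE_self, imE_nbr hA _ k m hk]
    refine PSer.central_left (Kinv_comm _ _) ?_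
    have := (serre_xdown_yel v_ne (K_comm _ _) up (dn k hk)).smul 1 ((v - v⁻¹)⁻¹ * SDHall.sq⁻¹)
    rwa [one_smul] at this
  · subst hj
    omega
  · subst hk
    rw [imE_self, imE_nbr hA _ j m hj]
    refine PSer.central_right (Kinv_comm _ _) ?_
    have := (serre_yel_xdown v_ne (K_comm _ _) up (dn j hj) (E_pser j k m h)).smul
      ((v - v⁻¹)⁻¹ * SDHall.sq⁻¹) 1
    rwa [one_smul] at this
  · rw [imE_nbr hA _ j m hj, imE_nbr hA _ k m hk]
    exact (yel_serre_near v (mul_ne_zero v_ne1 v_ne2) _ _ _ (E_pser i j m hj) (E_pser i k m hk)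
      (E_pser j k m h)).smul _ _
  · rw [imE_nbr hA _ j m hj, imE_far hA _ k m hk]
    have := (yel_serre_far v v_ne1 _ _ _ (E_pser i j m hj) (E_pser j k m h)
      (E_comm i k m hk)).smul ((v - v⁻¹)⁻¹ * SDHall.sq⁻¹) 1
    rwa [one_smul] at this
  · subst hk; rw [hA.1] at hj; omega
  · rw [imE_far hA _ j m hj, imE_nbr hA _ k m hk]
    have := (yel_serre_far' v _ _ _ (E_pser j k m h) (E_comm i j m hj)).smul 1
      ((v - v⁻¹)⁻¹ * SDHall.sq⁻¹)
    rwa [one_smul] at this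
  · rw [imE_far hA i j m hj, imE_far hA i k m hk]
    exact E_pser j k m h

theorem im_sd4_eq (hA : IsCartan a) (i j : I) (m : ℤ) :
    imE a i j (m + 1) * imE a i j m =
      (v ^ 2) • (imE a i j m * imE a i j (m + 1)) + (1 - v ^ 2) • imK a i j m := by
  rcases tri hA i j with rfl | hj | hj
  · rw [imE_self, imE_self, imK_self]
    have h := E_up hA j (m - 1)
    rw [sub_add_cancel] at h
    rw [show m + 1 - 1 = m by ring]
    have e1 : ∀ p q : A a, p * Kinv a j m * (q * Kinv a j (m - 1)) =
        p * q * (Kinv a j (m - 1) * Kinv a j m) := by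
      intro p q
      rw [mul_assoc, Kinv_comm j m, mul_assoc, mul_assoc]
    have e2 : ∀ p q : A a, p * Kinv a j (m - 1) * (q * Kinv a j m) =
        p * q * (Kinv a j (m - 1) * Kinv a j m) := by
      intro p q
      rw [mul_assoc, ← mul_assoc (Kinv a j (m - 1)), Kinv_comm j (m - 1), mul_assoc, mul_assoc]
    rw [e1, e2, h, add_mul, smul_mul_assoc, smul_mul_assoc, ← mul_assoc (K a j (m - 1)), K_Kinv,
      one_mul]
  · rw [imE_nbr hA _ j _ hj, imE_nbr hA _ j _ hj, imK_nbr hA _ j _ hj]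
    have hne := nbr_ne hA hj
    have hj' : a j i = -1 := by rw [hA.1, hj]
    have q1 : QC v (-1) (E a i (m + 1)) (E a j m) := by
      refine (E_qc hA j i (m + 1) m (by omega) (Or.inl hne)).cast ?_
      rw [hj', show m + 1 - m = 1 by ring, sgn_one]; norm_num
    have q2 : QC v (-1) (E a j (m + 1)) (E a i m) := by
      refine (E_qc hA i j (m + 1) m (by omega) (Or.inl hne.symm)).cast ?_
      rw [hj, show m + 1 - m = 1 by ring, sgn_one]; norm_num
    have hK : ∀ s, ((1 - v ^ 2) • K a j m) * s = s * ((1 - v ^ 2) • K a j m) := by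
      intro s
      rw [smul_mul_assoc, K_comm, mul_smul_comm]
    have := yelup_yel v_ne (v ^ 2) (K_comm i m) hK (E_up hA i m) q1 q2 (E_up hA j m)
    rw [smul_mul_assoc, mul_smul_comm, this, K_comm i m, smul_mul_assoc, smul_mul_assoc,
      mul_smul_comm]
    have hv := v_ne
    have hs := sq_ne
    have h3 := v_ne3
    have h4 := v_ne4
    have hc : ((v - v⁻¹)⁻¹ * SDHall.sq⁻¹) * ((v - v⁻¹)⁻¹ * SDHall.sq⁻¹) *
        ((v - v⁻¹) * (v ^ 2 - 1)) = (1 : F₀) := by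
      have e : (v : F₀) ^ 2 - 1 = SDHall.sq * SDHall.sq * (v - v⁻¹) := by
        rw [← pow_two, show SDHall.sq ^ 2 = v from rfl]
        field_simp
      rw [e]
      generalize (v - v⁻¹ : F₀) = d at *
      field_simp
    exact scale_up _ _ _ _ hc _ _
  · rw [imE_far hA _ j _ hj, imE_far hA _ j _ hj, imK_far hA _ j _ hj]
    exact E_up hA j m

theorem im_qc (hA : IsCartan a) (i k j : I) (r l : ℤ) (h : r > l) (h' : k ≠ j ∨ r ≠ l + 1) :
    QC v (-(sgn (r - l)) * a k j) (imE a i j r) (imE a i k l) := by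
  have hv := v_ne
  have s1 : sgn (r - (l - 1)) = - sgn (r - l) := by
    rw [← sgn_succ]; congr 1; ring
  have s2 : sgn (r - 1 - l) = - sgn (r - l) := by
    rw [show r - l = (r - 1 - l) + 1 by ring, sgn_succ, neg_neg]
  rcases tri hA i j with hj | hj | hj <;> rcases tri hA i k with hk | hk | hk
  · subst hj; subst hk
    have hr : r ≠ l + 1 := by
      rcases h' with h' | h'
      · exact absurd rfl h'
      · exact h'
    rw [imE_self, imE_self]
    refine QC.central_left (Kinv_comm _ _) (QC.central_right (Kinv_comm _ _) ?_)
    refine (E_qc hA k k (r - 1) (l - 1) (by omega) (Or.inr (by omega))).cast ?_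
    rw [show r - 1 - (l - 1) = r - l by ring]
  · subst hj
    have hk' : a k j = -1 := by rw [hA.1, hk]
    rw [imE_self, imE_nbr hA _ k _ hk]
    refine QC.central_left (Kinv_comm _ _) (QC.smul_right _ ?_)
    by_cases h1 : r = l + 1
    · subst h1
      rw [show l + 1 - 1 = l by ring, show l + 1 - l = 1 by ring, sgn_one, hk']
      exact (x_yel hv (E_pser j k l hk)).cast (by norm_num)
    by_cases h2 : r = l + 2
    · subst h2
      rw [show l + 2 - 1 = l + 1 by ring, show l + 2 - l = 2 by ring, sgn_two, hk']
      refine (xup_yel hv (K_comm j l) (E_up hA j l) ?_).cast (by norm_num)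
      refine (E_qc hA k j (l + 1) l (by omega) (Or.inl (nbr_ne hA hk))).cast ?_
      rw [hk', show l + 1 - l = 1 by ring, sgn_one]; norm_num
    · refine (QC.yel_right hv (E_qc hA k j (r - 1) l (by omega) (Or.inr (by omega)))
        (E_qc hA j j (r - 1) l (by omega) (Or.inr (by omega)))).cast ?_
      rw [s2, hk', hA.2.1]; ring
  · subst hj
    have hk' : a k j = 0 := by rw [hA.1, hk]
    rw [imE_self, imE_far hA _ k _ hk]
    refine QC.central_left (Kinv_comm _ _) ?_
    rw [hk', mul_zero]
    by_cases h1 : r = l + 1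
    · subst h1
      rw [show l + 1 - 1 = l by ring]
      exact qc_comm (E_comm j k l hk)
    · refine (E_qc hA k j (r - 1) l (by omega) (Or.inl (far_ne hA hk))).cast ?_
      rw [hk', mul_zero]
  · subst hk
    rw [imE_self, imE_nbr hA _ j _ hj]
    refine QC.central_right (Kinv_comm _ _) (QC.smul_left _ ?_)
    refine (QC.yel_left hv (E_qc hA k j r (l - 1) (by omega) (Or.inr (by omega)))
        (E_qc hA k k r (l - 1) (by omega) (Or.inr (by omega)))).cast ?_
    rw [s1, hj, hA.2.1]; ring
  · have hk' : a k i = -1 := by rw [hA.1, hk]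
    rw [imE_nbr hA _ j _ hj, imE_nbr hA _ k _ hk]
    refine QC.smul_left _ (QC.smul_right _ ?_)
    by_cases h1 : r = l + 1
    · subst h1
      have hkj : k ≠ j := by
        rcases h' with h' | h'
        · exact h'
        · exact absurd rfl h'
      have q1 : QC v (-1) (E a i (l + 1)) (E a k l) := by
        refine (E_qc hA k i (l + 1) l (by omega) (Or.inl (nbr_ne hA hk))).cast ?_
        rw [hk', show l + 1 - l = 1 by ring, sgn_one]; norm_num
      have q2 : QC v (-1) (E a j (l + 1)) (E a i l) := by
        refine (E_qc hA i j (l + 1) l (by omega) (Or.inl (nbr_ne hA hj).symm)).cast ?_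
        rw [hj, show l + 1 - l = 1 by ring, sgn_one]; norm_num
      have q3 := E_qc hA k j (l + 1) l (by omega) (Or.inl hkj)
      unfold QC at q3
      have := yelup_yel (K := 0) hv _ (K_comm i l) (by simp) (E_up hA i l) q1 q2
        (by rw [add_zero]; exact q3)
      rw [zero_mul, smul_zero, add_zero] at this
      exact this
    · have b1 := QC.yel_left hv (E_qc hA k j r l h (Or.inr h1)) (E_qc hA k i r l h (Or.inr h1))
      have b2 := QC.yel_left hv (E_qc hA i j r l h (Or.inr h1)) (E_qc hA i i r l h (Or.inr h1))
      refine (QC.yel_right hv b1 b2).cast ?_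
      rw [hj, hk', hA.2.1]; ring
  · have hk' : a k i = 0 := by rw [hA.1, hk]
    have hjk : k ≠ j := by rintro rfl; omega
    rw [imE_nbr hA _ j _ hj, imE_far hA _ k _ hk]
    refine QC.smul_left _ ?_
    refine (QC.yel_left hv (E_qc hA k j r l h (Or.inl hjk))
      (E_qc hA k i r l h (Or.inl (far_ne hA hk)))).cast ?_
    rw [hk']; ring
  · subst hk
    rw [imE_self, imE_far hA _ j _ hj]
    refine QC.central_right (Kinv_comm _ _) ?_
    refine (E_qc hA k j r (l - 1) (by omega) (Or.inr (by omega))).cast ?_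
    rw [hj]; ring
  · have hjk : k ≠ j := by rintro rfl; omega
    rw [imE_far hA _ j _ hj, imE_nbr hA _ k _ hk]
    refine QC.smul_right _ ?_
    refine (QC.yel_right hv (E_qc hA k j r l h (Or.inl hjk))
      (E_qc hA i j r l h (Or.inl (far_ne hA hj).symm))).cast ?_
    rw [hj]; ring
  · rw [imE_far hA _ j _ hj, imE_far hA _ k _ hk]
    exact E_qc hA k j r l h h'

/-- The images of all generators. -/
def imG (a : I → I → ℤ) (i : I) : Gen I → A a
  | Gen.E j m => imE a i j m
  | Gen.K j m => imK a i j m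
  | Gen.Kinv j m => imKinv a i j m

theorem lift_rel (hA : IsCartan a) (i : I) ⦃x y : FreeAlgebra F₀ (Gen I)⦄ (h : Rel a x y) :
    FreeAlgebra.lift F₀ (imG a i) x = FreeAlgebra.lift F₀ (imG a i) y := by
  have hE : ∀ j m, FreeAlgebra.lift F₀ (imG a i) (e j m) = imE a i j m := fun j m => by
    simp [e, imG]
  have hK : ∀ j m, FreeAlgebra.lift F₀ (imG a i) (κ j m) = imK a i j m := fun j m => by
    simp [κ, imG]
  have hK' : ∀ j m, FreeAlgebra.lift F₀ (imG a i) (κ' j m) = imKinv a i j m := fun j m => by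
    simp [κ', imG]
  cases h with
  | sd0a j m => rw [map_mul, hK, hK', map_one, imK_imKinv]
  | sd0b j m => rw [map_mul, hK, hK', map_one, imKinv_imK]
  | sd1 j m x => rw [map_mul, map_mul, hK, imK_comm]
  | sd2 j k m h => rw [map_mul, map_mul, hE, hE, im_sd2 hA i j k m h]
  | sd3 j k m h =>
    simp only [map_add, map_sub, map_mul, map_smul, map_pow, map_zero, hE]
    exact of_pser v_ne (im_sd3 hA i j k m h)
  | sd4_ne j k m h =>
    simp only [map_mul, map_smul, hE]
    have := im_qc hA i k j (m + 1) m (by omega) (Or.inl h.symm)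
    unfold QC at this
    rw [this, show m + 1 - m = 1 by ring, sgn_one, hA.1 k j]
    norm_num
  | sd4_eq j m =>
    simp only [map_add, map_mul, map_smul, hE, hK]
    rw [hA.2.1]
    exact im_sd4_eq hA i j m
  | sd5 k j r l h =>
    simp only [map_mul, map_smul, hE]
    exact im_qc hA i k j r l (by omega) (Or.inr (by omega))

theorem spec_unique (hA : IsCartan a) (i : I) (σ τ : A a →ₐ[F₀] A a) (hs : SigmaSpec' a i σ)
    (ht : SigmaSpec' a i τ) : σ = τ := by
  obtain ⟨s1, s2, s3, s4, s5, s6⟩ := hs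
  obtain ⟨t1, t2, t3, t4, t5, t6⟩ := ht
  have hE : ∀ j m, σ (E a j m) = τ (E a j m) := by
    intro j m
    rcases tri hA i j with rfl | hj | hj
    · rw [s1, t1]
    · rw [s2 _ _ hj, t2 _ _ hj]
    · rw [s3 _ _ hj, t3 _ _ hj]
  have hK : ∀ j m, σ (K a j m) = τ (K a j m) := by
    intro j m
    rcases tri hA i j with rfl | hj | hj
    · rw [s4, t4]
    · rw [s5 _ _ hj, t5 _ _ hj]
    · rw [s6 _ _ hj, t6 _ _ hj]
  have hK' : ∀ j m, σ (Kinv a j m) = τ (Kinv a j m) := by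
    intro j m
    refine left_inv_eq_right_inv (a := σ (K a j m)) ?_ ?_
    · rw [← map_mul, Kinv_K, map_one]
    · rw [hK, ← map_mul, K_Kinv, map_one]
  apply RingQuot.ringQuot_ext'
  apply FreeAlgebra.hom_ext
  funext g
  cases g with
  | E j m => exact hE j m
  | K j m => exact hK j m
  | Kinv j m => exact hK' j m

end Concrete

end SDAux

/-- For every `i ∈ I` there is a unique `F`-algebra endomorphism `σᵢ'` of
`𝒜` satisfying the inverse braid group action formulas on the generators. -/
theorem sigma'_existsUnique (I : Type) [Fintype I] (a : I → I → ℤ)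
    (hA : IsCartan a) (i : I) :
    ∃! σ : A a →ₐ[F₀] A a, SigmaSpec' a i σ := by
  have hex : ∃ σ : A a →ₐ[F₀] A a, SigmaSpec' a i σ := by
    refine ⟨RingQuot.liftAlgHom F₀ ⟨FreeAlgebra.lift F₀ (SDAux.imG a i), SDAux.lift_rel hA i⟩, ?_⟩
    have hE : ∀ j m, RingQuot.liftAlgHom F₀
        ⟨FreeAlgebra.lift F₀ (SDAux.imG a i), SDAux.lift_rel hA i⟩ (E a j m) =
        SDAux.imE a i j m := fun j m => by
      unfold E
      rw [RingQuot.liftAlgHom_mkAlgHom_apply]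
      simp [e, SDAux.imG]
    have hK : ∀ j m, RingQuot.liftAlgHom F₀
        ⟨FreeAlgebra.lift F₀ (SDAux.imG a i), SDAux.lift_rel hA i⟩ (K a j m) =
        SDAux.imK a i j m := fun j m => by
      unfold K
      rw [RingQuot.liftAlgHom_mkAlgHom_apply]
      simp [κ, SDAux.imG]
    refine ⟨fun m => ?_, fun j m hj => ?_, fun j m hj => ?_, fun m => ?_, fun j m hj => ?_,
      fun j m hj => ?_⟩
    · rw [hE, SDAux.imE_self]
    · rw [hE, SDAux.imE_nbr hA _ _ _ hj, SDAux.T_eq]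
    · rw [hE, SDAux.imE_far hA _ _ _ hj]
    · rw [hK, SDAux.imK_self]
    · rw [hK, SDAux.imK_nbr hA _ _ _ hj]
    · rw [hK, SDAux.imK_far hA _ _ _ hj]
  obtain ⟨σ, hσ⟩ := hex
  exact ⟨σ, hσ, fun τ hτ => SDAux.spec_unique hA i τ σ hτ hσ⟩
end
end

section
/- There is a group homomorphism from the braid group B associated with A — i.e., the group presented by generators s_i (i ∈ I) subject to s_i s_j s_i = s_j s_i s_j whenever a_{ij} = −1 and s_i s_j = s_j s_i whenever i ≠ j and a_{ij} = 0 — to the group of F-algebra automorphisms of 𝒜, sending each generator s_i to σ_i. In other words, the braid group B acts on the twisted semi-derived Hall algebra 𝒜 by the automorphisms σ_i. -/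
/-!
Braid group action on the twisted semi-derived Hall algebra (Contu, arXiv:2410.18604).

We work with the algebra `𝒜 = 𝒮𝒟ℋ_tw(C^b(𝒫))` given by its presentation
(Proposition `prop_presenentation_semiderived_E_i` of the paper): generators
`E_{i,m}`, `K_{i,m}`, `K_{i,m}⁻¹` (`i ∈ I`, `m ∈ ℤ`) over `F = ℚ(v^{1/2})`,
subject to the relations (SD0)–(SD5).
-/

noncomputable section

open SDHall

namespace SDHall

variable {I : Type}

/-- The braid relations associated with the generalized Cartan matrix `a`:
`sᵢsⱼsᵢ = sⱼsᵢsⱼ` whenever `a_{ij} = −1`, and `sᵢsⱼ = sⱼsᵢ` whenever `i ≠ j` and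
`a_{ij} = 0`, written as relators in the free group on `I`. -/
def braidRels (a : I → I → ℤ) : Set (FreeGroup I) :=
  {w | ∃ i j, a i j = -1 ∧
      w = FreeGroup.of i * FreeGroup.of j * FreeGroup.of i *
        (FreeGroup.of j)⁻¹ * (FreeGroup.of i)⁻¹ * (FreeGroup.of j)⁻¹} ∪
  {w | ∃ i j, i ≠ j ∧ a i j = 0 ∧
      w = FreeGroup.of i * FreeGroup.of j * (FreeGroup.of i)⁻¹ * (FreeGroup.of j)⁻¹}

/-- The braid group `B` of `a`, presented by generators `sᵢ` and the braid relations. -/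
abbrev BraidGroup (a : I → I → ℤ) : Type := PresentedGroup (braidRels a)

end SDHall

namespace SDHall

/-- The `q`-commutator with generic coefficients. -/
def tt {k R : Type*} [Field k] [Ring R] [Algebra k R] (c s : k) (x y : R) : R :=
  c • (s • (x * y) - s⁻¹ • (y * x))

section generic

variable {k R : Type*} [Field k] [Ring R] [Algebra k R]

/-- If `x` and `z` commute the `q`-commutator is associative on `x, y, z`. -/
lemma tt_assoc (c s : k) (x y z : R) (h : x * z = z * x) :
    tt c s (tt c s x y) z = tt c s x (tt c s y z) := by
  have h1 : z * x * y = x * z * y := by rw [h]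
  have h2 : y * z * x = y * x * z := by rw [mul_assoc, ← h, mul_assoc]
  simp only [mul_assoc] at h1 h2
  simp only [tt, mul_sub, sub_mul, smul_sub, mul_smul_comm, smul_mul_assoc, smul_smul, mul_assoc,
    h1, h2]
  module

/-- If `x` and `y` commute then so do the `q`-commutator operators. -/
lemma tt_comm (c s : k) (x y z : R) (h : x * y = y * x) :
    tt c s x (tt c s y z) = tt c s y (tt c s x z) := by
  have h1 : z * x * y = z * y * x := by rw [mul_assoc, h, mul_assoc]
  have h2 : x * y * z = y * x * z := by rw [h]
  simp only [mul_assoc] at h1 h2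
  simp only [tt, mul_sub, sub_mul, smul_sub, mul_smul_comm, smul_mul_assoc, smul_smul, mul_assoc,
    h1, h2]
  module

/-- The triangle identity, a consequence of the quantum Serre relations. -/
lemma tt_triangle (c s : k) (hs : s ≠ 0) (hs4 : s ^ 4 + 1 ≠ 0) (x y z : R)
    (hxy : x ^ 2 * y - (s ^ 2 + (s ^ 2)⁻¹) • (x * y * x) + y * x ^ 2 = 0)
    (hxz : x ^ 2 * z - (s ^ 2 + (s ^ 2)⁻¹) • (x * z * x) + z * x ^ 2 = 0)
    (hyz : y ^ 2 * z - (s ^ 2 + (s ^ 2)⁻¹) • (y * z * y) + z * y ^ 2 = 0) :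
    tt c s y (tt c s (tt c s x y) (tt c s x z)) =
      tt c s x (tt c s (tt c s y x) (tt c s y z)) := by
  have key : ∀ w : R, w = 0 → ∀ l r : R, l * (w * r) = 0 := by
    rintro w rfl l r; simp
  have a1 := key _ hxy 1 (y * z)
  have a2 := key _ hxy y z
  have a3 := key _ hxy z y
  have a4 := key _ hxy (z * y) 1
  have a5 := key _ hxz 1 (y * y)
  have a6 := key _ hxz y y
  have a7 := key _ hxz (y * y) 1
  have a8 := key _ hyz 1 (x * x)
  have a9 := key _ hyz x x
  have a10 := key _ hyz (x * x) 1
  simp only [pow_two x, pow_two y, mul_sub, sub_mul, mul_add, add_mul, mul_smul_comm,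
    smul_mul_assoc, mul_assoc, one_mul, mul_one] at a1 a2 a3 a4 a5 a6 a7 a8 a9 a10
  simp only [tt, mul_sub, sub_mul, smul_sub, mul_smul_comm, smul_mul_assoc, smul_smul, mul_assoc]
  linear_combination (norm := skip) (c ^ 4 * (s ^ 2)⁻¹ * (s ^ 4 + 1)⁻¹) •
    (s ^ 8 • a1 - s ^ 8 • a2 - a3 + a4 - s ^ 4 • a5 + (s ^ 2 + s ^ 6) • a6 - s ^ 4 • a7
      + s ^ 4 • a8 - (s ^ 2 + s ^ 6) • a9 + s ^ 4 • a10)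
  match_scalars <;> field_simp <;> ring

/-- The rank two computation giving `σᵢ σⱼ Eᵢ = Eⱼ`. -/
lemma tt_rank_two (s : k) (hs : s ≠ 0) (hv : s ^ 2 - (s ^ 2)⁻¹ ≠ 0) (x x' y κ κ' : R)
    (hκ : κ * κ' = 1) (hc : ∀ z, κ' * z = z * κ')
    (h1 : x' * x = (s ^ 2) ^ (2 : ℤ) • (x * x') + (1 - (s ^ 2) ^ 2) • κ)
    (hcκ : ∀ z, κ * z = z * κ)
    (h2 : x' * y = (s ^ 2) ^ (-1 : ℤ) • (y * x')) :
    tt (s ^ 2 - (s ^ 2)⁻¹)⁻¹ s (tt (s ^ 2 - (s ^ 2)⁻¹)⁻¹ s x y) (x' * κ') = y := by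
  have e1 : x' * (x * y) = (s ^ 2) • (x * (y * x')) + (1 - (s ^ 2) ^ 2) • (y * κ) := by
    rw [← mul_assoc, h1, add_mul, smul_mul_assoc, mul_assoc, h2, smul_mul_assoc, hcκ,
      mul_smul_comm, smul_smul]
    congr 2
    field_simp
  have e2 : x' * (y * x) = (s ^ 2) • (y * (x * x')) +
      ((s ^ 2)⁻¹ * (1 - (s ^ 2) ^ 2)) • (y * κ) := by
    rw [← mul_assoc, h2, smul_mul_assoc, mul_assoc, h1, mul_add, mul_smul_comm, mul_smul_comm,
      smul_add, smul_smul, smul_smul, zpow_neg_one]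
    congr 2
    field_simp
  have hy : y = (y * κ) * κ' := by rw [mul_assoc, hκ, mul_one]
  set t := tt (s ^ 2 - (s ^ 2)⁻¹)⁻¹ s x y with ht
  have e3 : x' * t = (s ^ 2) • (t * x') +
      ((s ^ 2 - (s ^ 2)⁻¹)⁻¹ * (1 - (s ^ 2) ^ 2) * (s - s⁻¹ * (s ^ 2)⁻¹)) • (y * κ) := by
    simp only [ht, tt, mul_sub, sub_mul, smul_sub, mul_smul_comm, smul_mul_assoc, smul_smul,
      mul_assoc, e1, e2]
    module
  have e4 : tt (s ^ 2 - (s ^ 2)⁻¹)⁻¹ s t (x' * κ') =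
      (s ^ 2 - (s ^ 2)⁻¹)⁻¹ • ((s • (t * x') - s⁻¹ • (x' * t)) * κ') := by
    have : x' * κ' * t = x' * t * κ' := by rw [mul_assoc, hc, mul_assoc]
    simp only [tt, this, sub_mul, smul_mul_assoc, mul_assoc]
  rw [e4, e3]
  conv_rhs => rw [hy]
  rw [← smul_mul_assoc]
  congr 1
  match_scalars
  · field_simp
    ring
  · have h4 : s ^ 4 - 1 ≠ 0 := by
      intro h
      apply hv
      field_simp
      linear_combination h
    field_simp
    ring

end generic

lemma sq_ne : sq ≠ 0 := RatFunc.X_ne_zero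

lemma sq4_sub_ne : sq ^ 4 - 1 ≠ 0 := by
  intro h
  have h2 : algebraMap (Polynomial ℚ) (RatFunc ℚ) (Polynomial.X ^ 4 - 1) = 0 := by
    simpa [sq] using h
  rw [map_eq_zero_iff _ (RatFunc.algebraMap_injective ℚ)] at h2
  have := congrArg (Polynomial.eval 0) h2
  simp at this

lemma sq4_add_ne : sq ^ 4 + 1 ≠ 0 := by
  intro h
  have h2 : algebraMap (Polynomial ℚ) (RatFunc ℚ) (Polynomial.X ^ 4 + 1) = 0 := by
    simpa [sq] using h
  rw [map_eq_zero_iff _ (RatFunc.algebraMap_injective ℚ)] at h2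
  have := congrArg (Polynomial.eval 0) h2
  simp at this

lemma v_sub_ne : sq ^ 2 - (sq ^ 2)⁻¹ ≠ 0 := by
  intro h
  apply sq4_sub_ne
  have := sq_ne
  field_simp at h
  linear_combination h

section algebra

variable (a : I → I → ℤ)

lemma T_eq (i j : I) (m : ℤ) :
    T a i j m = tt (sq ^ 2 - (sq ^ 2)⁻¹)⁻¹ sq (E a i m) (E a j m) := rfl

lemma K_mul_Kinv (i : I) (m : ℤ) : K a i m * Kinv a i m = 1 := by
  have := RingQuot.mkAlgHom_rel F₀ (Rel.sd0a (a := a) i m)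
  simpa [K, Kinv] using this

lemma Kinv_mul_K (i : I) (m : ℤ) : Kinv a i m * K a i m = 1 := by
  have := RingQuot.mkAlgHom_rel F₀ (Rel.sd0b (a := a) i m)
  simpa [K, Kinv] using this

lemma K_comm (i : I) (m : ℤ) (x : A a) : K a i m * x = x * K a i m := by
  obtain ⟨y, rfl⟩ := RingQuot.mkAlgHom_surjective F₀ (Rel a) x
  have := RingQuot.mkAlgHom_rel F₀ (Rel.sd1 (a := a) i m y)
  simpa [K] using this

lemma Kinv_comm (i : I) (m : ℤ) (x : A a) : Kinv a i m * x = x * Kinv a i m := by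
  calc Kinv a i m * x = Kinv a i m * x * (K a i m * Kinv a i m) := by
        rw [K_mul_Kinv, mul_one]
    _ = Kinv a i m * (x * K a i m) * Kinv a i m := by simp only [mul_assoc]
    _ = (Kinv a i m * K a i m) * x * Kinv a i m := by rw [← K_comm]; simp only [mul_assoc]
    _ = x * Kinv a i m := by rw [Kinv_mul_K, one_mul]

lemma E_comm (i j : I) (m : ℤ) (h : a i j = 0) :
    E a i m * E a j m = E a j m * E a i m := by
  have := RingQuot.mkAlgHom_rel F₀ (Rel.sd2 (a := a) i j m h)
  simpa [E] using this

lemma E_serre (i j : I) (m : ℤ) (h : a i j = -1) :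
    E a i m ^ 2 * E a j m - (sq ^ 2 + (sq ^ 2)⁻¹) • (E a i m * E a j m * E a i m)
      + E a j m * E a i m ^ 2 = 0 := by
  have := RingQuot.mkAlgHom_rel F₀ (Rel.sd3 (a := a) i j m h)
  simpa only [E, v, map_add, map_sub, map_mul, map_pow, map_smul, map_zero] using this

lemma E_sd4_ne (i j : I) (m : ℤ) (h : i ≠ j) :
    E a i (m + 1) * E a j m = ((sq ^ 2) ^ (a i j)) • (E a j m * E a i (m + 1)) := by
  have := RingQuot.mkAlgHom_rel F₀ (Rel.sd4_ne (a := a) i j m h)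
  simpa only [E, v, map_mul, map_smul] using this

lemma E_sd4_eq (i : I) (m : ℤ) :
    E a i (m + 1) * E a i m = ((sq ^ 2) ^ (a i i)) • (E a i m * E a i (m + 1))
      + ((1 : F₀) - (sq ^ 2) ^ 2) • K a i m := by
  have := RingQuot.mkAlgHom_rel F₀ (Rel.sd4_eq (a := a) i m)
  simpa only [E, K, v, map_add, map_mul, map_smul] using this

variable {a}

/-- An algebra map preserves the `q`-commutator. -/
lemma map_tt (f : A a ≃ₐ[F₀] A a) (c s : F₀) (x y : A a) :
    f (tt c s x y) = tt c s (f x) (f y) := by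
  simp only [tt, map_sub, map_mul, map_smul]

/-- Inverse elements map to inverse elements. -/
lemma map_Kinv_eq (f : A a ≃ₐ[F₀] A a) (i : I) (m : ℤ) (y : A a)
    (h : f (K a i m) * y = 1) : f (Kinv a i m) = y := by
  have h1 : f (Kinv a i m) * f (K a i m) = 1 := by rw [← map_mul, Kinv_mul_K, map_one]
  exact left_inv_eq_right_inv h1 h

/-- Automorphisms which agree on the `E` and the `K` agree. -/
lemma aut_ext (f g : A a ≃ₐ[F₀] A a) (hE : ∀ i m, f (E a i m) = g (E a i m))
    (hK : ∀ i m, f (K a i m) = g (K a i m)) : f = g := by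
  have : (f : A a →ₐ[F₀] A a) = g := by
    apply RingQuot.ringQuot_ext'
    apply FreeAlgebra.hom_ext
    funext x
    cases x with
    | E i m => exact hE i m
    | K i m => exact hK i m
    | Kinv i m =>
      have h := map_Kinv_eq f i m (g (Kinv a i m)) (by
        rw [hK, ← map_mul, K_mul_Kinv, map_one])
      exact h
  ext x
  exact AlgHom.congr_fun this x

end algebra

section action

variable {a : I → I → ℤ}

section spec

variable {σ : I → (A a ≃ₐ[F₀] A a)}

lemma σE_self {i : I} (h : SigmaSpec a i (σ i).toAlgHom) (m : ℤ) :
    σ i (E a i m) = E a i (m + 1) * Kinv a i m := h.1 m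

lemma σE_neg {i j : I} (h : SigmaSpec a i (σ i).toAlgHom) (hij : a i j = -1) (m : ℤ) :
    σ i (E a j m) = tt (sq ^ 2 - (sq ^ 2)⁻¹)⁻¹ sq (E a i m) (E a j m) := h.2.1 j m hij

lemma σE_zero {i j : I} (h : SigmaSpec a i (σ i).toAlgHom) (hij : a i j = 0) (m : ℤ) :
    σ i (E a j m) = E a j m := h.2.2.1 j m hij

lemma σK_self {i : I} (h : SigmaSpec a i (σ i).toAlgHom) (m : ℤ) :
    σ i (K a i m) = Kinv a i m := h.2.2.2.1 m

lemma σK_neg {i j : I} (h : SigmaSpec a i (σ i).toAlgHom) (hij : a i j = -1) (m : ℤ) :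
    σ i (K a j m) = K a i m * K a j m := h.2.2.2.2.1 j m hij

lemma σK_zero {i j : I} (h : SigmaSpec a i (σ i).toAlgHom) (hij : a i j = 0) (m : ℤ) :
    σ i (K a j m) = K a j m := h.2.2.2.2.2 j m hij

lemma σKinv_zero {i j : I} (h : SigmaSpec a i (σ i).toAlgHom) (hij : a i j = 0) (m : ℤ) :
    σ i (Kinv a j m) = Kinv a j m :=
  map_Kinv_eq _ _ _ _ (by rw [σK_zero h hij, K_mul_Kinv])

end spec

/-- `σᵢ σⱼ Eᵢ = Eⱼ`. -/
lemma two_E (hA : IsCartan a) (σ : I → (A a ≃ₐ[F₀] A a))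
    (hσ : ∀ i, SigmaSpec a i (σ i).toAlgHom) {i j : I} (hij : a i j = -1) (m : ℤ) : σ i (σ j (E a i m)) = E a j m := by
  have hne : i ≠ j := by
    rintro rfl
    have := hA.2.1 i
    omega
  have hji : a j i = -1 := by rw [hA.1, hij]
  rw [σE_neg (hσ j) hji, map_tt, σE_neg (hσ i) hij, σE_self (hσ i)]
  have h1 := E_sd4_eq a i m
  have h2 := E_sd4_ne a i j m hne
  rw [hA.2.1] at h1
  rw [hij] at h2
  exact tt_rank_two sq sq_ne v_sub_ne _ _ _ _ _ (K_mul_Kinv a i m) (Kinv_comm a i m) h1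
    (K_comm a i m) h2

/-- `σᵢ σⱼ Kᵢ = Kⱼ`. -/
lemma two_K (hA : IsCartan a) (σ : I → (A a ≃ₐ[F₀] A a))
    (hσ : ∀ i, SigmaSpec a i (σ i).toAlgHom) {i j : I} (hij : a i j = -1) (m : ℤ) : σ i (σ j (K a i m)) = K a j m := by
  have hji : a j i = -1 := by rw [hA.1, hij]
  rw [σK_neg (hσ j) hji, map_mul, σK_neg (hσ i) hij, σK_self (hσ i), mul_assoc, K_comm, mul_assoc,
    Kinv_mul_K, mul_one]

lemma two_Kinv (hA : IsCartan a) (σ : I → (A a ≃ₐ[F₀] A a))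
    (hσ : ∀ i, SigmaSpec a i (σ i).toAlgHom) {i j : I} (hij : a i j = -1) (m : ℤ) :
    σ i (σ j (Kinv a i m)) = Kinv a j m := by
  have := map_Kinv_eq (σ i * σ j) i m (Kinv a j m) (by
    rw [AlgEquiv.mul_apply, two_K hA σ hσ hij, K_mul_Kinv])
  exact this

lemma braid_self (hA : IsCartan a) (σ : I → (A a ≃ₐ[F₀] A a))
    (hσ : ∀ i, SigmaSpec a i (σ i).toAlgHom) {i j : I} (hij : a i j = -1) (m : ℤ) :
    σ i (σ j (σ i (E a i m))) = σ j (σ i (σ j (E a i m))) := by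
  rw [two_E hA σ hσ hij, σE_self (hσ i), σE_self (hσ j), map_mul, map_mul, two_E hA σ hσ hij,
    two_Kinv hA σ hσ hij]

lemma braid_selfK (hA : IsCartan a) (σ : I → (A a ≃ₐ[F₀] A a))
    (hσ : ∀ i, SigmaSpec a i (σ i).toAlgHom) {i j : I} (hij : a i j = -1) (m : ℤ) :
    σ i (σ j (σ i (K a i m))) = σ j (σ i (σ j (K a i m))) := by
  rw [two_K hA σ hσ hij, σK_self (hσ i), σK_self (hσ j), two_Kinv hA σ hσ hij]

lemma braid_one (hA : IsCartan a) (σ : I → (A a ≃ₐ[F₀] A a))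
    (hσ : ∀ i, SigmaSpec a i (σ i).toAlgHom) {i j k : I} (hij : a i j = -1) (hik : a i k = -1) (hjk : a j k = 0) (m : ℤ) :
    σ i (σ j (σ i (E a k m))) = σ j (σ i (σ j (E a k m))) := by
  have hji : a j i = -1 := by rw [hA.1, hij]
  rw [σE_neg (hσ i) hik, map_tt, map_tt, two_E hA σ hσ hij, σE_zero (hσ j) hjk,
    σE_neg (hσ i) hik, map_tt, σE_neg (hσ j) hji, σE_zero (hσ j) hjk,
    tt_assoc _ _ _ _ _ (E_comm a j k m hjk)]

lemma braid_oneK (hA : IsCartan a) (σ : I → (A a ≃ₐ[F₀] A a))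
    (hσ : ∀ i, SigmaSpec a i (σ i).toAlgHom) {i j k : I} (hij : a i j = -1) (hik : a i k = -1) (hjk : a j k = 0) (m : ℤ) :
    σ i (σ j (σ i (K a k m))) = σ j (σ i (σ j (K a k m))) := by
  have hji : a j i = -1 := by rw [hA.1, hij]
  rw [σK_neg (hσ i) hik, map_mul, map_mul, two_K hA σ hσ hij, σK_zero (hσ j) hjk,
    σK_neg (hσ i) hik, map_mul, σK_neg (hσ j) hji, σK_zero (hσ j) hjk, mul_assoc]

lemma braid_two (hA : IsCartan a) (σ : I → (A a ≃ₐ[F₀] A a))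
    (hσ : ∀ i, SigmaSpec a i (σ i).toAlgHom) {i j k : I} (hij : a i j = -1) (hik : a i k = -1) (hjk : a j k = -1) (m : ℤ) :
    σ i (σ j (σ i (E a k m))) = σ j (σ i (σ j (E a k m))) := by
  have hji : a j i = -1 := by rw [hA.1, hij]
  rw [σE_neg (hσ i) hik, map_tt, map_tt, two_E hA σ hσ hij, σE_neg (hσ j) hjk, map_tt,
    map_tt, two_E hA σ hσ hji, σE_neg (hσ i) hik, map_tt, σE_neg (hσ i) hij,
    σE_neg (hσ j) hji, σE_neg (hσ j) hjk]
  exact tt_triangle _ _ sq_ne sq4_add_ne _ _ _ (E_serre a i j m hij) (E_serre a i k m hik)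
    (E_serre a j k m hjk)

lemma braid_twoK (hA : IsCartan a) (σ : I → (A a ≃ₐ[F₀] A a))
    (hσ : ∀ i, SigmaSpec a i (σ i).toAlgHom) {i j k : I} (hij : a i j = -1) (hik : a i k = -1) (hjk : a j k = -1) (m : ℤ) :
    σ i (σ j (σ i (K a k m))) = σ j (σ i (σ j (K a k m))) := by
  have hji : a j i = -1 := by rw [hA.1, hij]
  rw [σK_neg (hσ i) hik, map_mul, map_mul, two_K hA σ hσ hij, σK_neg (hσ j) hjk, map_mul,
    map_mul, two_K hA σ hσ hji, σK_neg (hσ i) hik, map_mul, σK_neg (hσ i) hij,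
    σK_neg (hσ j) hji, σK_neg (hσ j) hjk]
  have h := K_comm a i m (K a j m)
  have h' : ∀ z : A a, K a i m * (K a j m * z) = K a j m * (K a i m * z) := by
    intro z
    rw [← mul_assoc, h, mul_assoc]
  simp only [mul_assoc, h']

lemma braid_rel (hA : IsCartan a) (σ : I → (A a ≃ₐ[F₀] A a))
    (hσ : ∀ i, SigmaSpec a i (σ i).toAlgHom) {i j : I} (hij : a i j = -1) : σ i * σ j * σ i = σ j * σ i * σ j := by
  have hji : a j i = -1 := by rw [hA.1, hij]
  apply aut_ext
  · intro k m
    simp only [AlgEquiv.mul_apply]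
    by_cases hki : i = k
    · subst hki
      exact braid_self hA σ hσ hij m
    by_cases hkj : j = k
    · subst hkj
      exact (braid_self hA σ hσ hji m).symm
    rcases hA.2.2 i k hki with hik | hik <;> rcases hA.2.2 j k hkj with hjk | hjk
    · simp only [σE_zero (hσ i) hik, σE_zero (hσ j) hjk]
    · exact (braid_one hA σ hσ hji hjk hik m).symm
    · exact braid_one hA σ hσ hij hik hjk m
    · exact braid_two hA σ hσ hij hik hjk m
  · intro k m
    simp only [AlgEquiv.mul_apply]
    by_cases hki : i = k
    · subst hki
      exact braid_selfK hA σ hσ hij m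
    by_cases hkj : j = k
    · subst hkj
      exact (braid_selfK hA σ hσ hji m).symm
    rcases hA.2.2 i k hki with hik | hik <;> rcases hA.2.2 j k hkj with hjk | hjk
    · simp only [σK_zero (hσ i) hik, σK_zero (hσ j) hjk]
    · exact (braid_oneK hA σ hσ hji hjk hik m).symm
    · exact braid_oneK hA σ hσ hij hik hjk m
    · exact braid_twoK hA σ hσ hij hik hjk m

lemma comm_rel (hA : IsCartan a) (σ : I → (A a ≃ₐ[F₀] A a))
    (hσ : ∀ i, SigmaSpec a i (σ i).toAlgHom) {i j : I} (hij : a i j = 0) : σ i * σ j = σ j * σ i := by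
  have hji : a j i = 0 := by rw [hA.1, hij]
  apply aut_ext
  · intro k m
    simp only [AlgEquiv.mul_apply]
    by_cases hki : i = k
    · subst hki
      rw [σE_zero (hσ j) hji, σE_self (hσ i), map_mul, σE_zero (hσ j) hji, σKinv_zero (hσ j) hji]
    by_cases hkj : j = k
    · subst hkj
      rw [σE_zero (hσ i) hij, σE_self (hσ j), map_mul, σE_zero (hσ i) hij, σKinv_zero (hσ i) hij]
    rcases hA.2.2 i k hki with hik | hik <;> rcases hA.2.2 j k hkj with hjk | hjk
    · simp only [σE_zero (hσ i) hik, σE_zero (hσ j) hjk]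
    · simp only [σE_zero (hσ i) hik, σE_neg (hσ j) hjk, map_tt, σE_zero (hσ i) hij]
    · simp only [σE_neg (hσ i) hik, σE_zero (hσ j) hjk, map_tt, σE_zero (hσ j) hji]
    · simp only [σE_neg (hσ i) hik, σE_neg (hσ j) hjk, map_tt, σE_zero (hσ i) hij,
        σE_zero (hσ j) hji]
      exact tt_comm _ _ _ _ _ (E_comm a j i m hji)
  · intro k m
    simp only [AlgEquiv.mul_apply]
    by_cases hki : i = k
    · subst hki
      rw [σK_zero (hσ j) hji, σK_self (hσ i), σKinv_zero (hσ j) hji]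
    by_cases hkj : j = k
    · subst hkj
      rw [σK_zero (hσ i) hij, σK_self (hσ j), σKinv_zero (hσ i) hij]
    rcases hA.2.2 i k hki with hik | hik <;> rcases hA.2.2 j k hkj with hjk | hjk
    · simp only [σK_zero (hσ i) hik, σK_zero (hσ j) hjk]
    · simp only [σK_zero (hσ i) hik, σK_neg (hσ j) hjk, map_mul, σK_zero (hσ i) hij]
    · simp only [σK_neg (hσ i) hik, σK_zero (hσ j) hjk, map_mul, σK_zero (hσ j) hji]
    · simp only [σK_neg (hσ i) hik, σK_neg (hσ j) hjk, map_mul, σK_zero (hσ i) hij,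
        σK_zero (hσ j) hji]
      rw [← mul_assoc, K_comm a j, mul_assoc]

end action

end SDHall

/-- The braid group `B` associated with `A` acts on the twisted
semi-derived Hall algebra `𝒜` by the automorphisms `σᵢ`: there is a group homomorphism
from `B` to the group of `F`-algebra automorphisms of `𝒜` sending each generator `sᵢ`
to `σᵢ`. -/
theorem braid_group_action (I : Type) [Fintype I] (a : I → I → ℤ)
    (hA : IsCartan a) (σ : I → (A a ≃ₐ[F₀] A a))
    (hσ : ∀ i, SigmaSpec a i (σ i).toAlgHom) :
    ∃ φ : BraidGroup a →* (A a ≃ₐ[F₀] A a),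
      ∀ i : I, φ (PresentedGroup.of i) = σ i := by
  refine ⟨PresentedGroup.toGroup (f := σ) ?_, fun i => PresentedGroup.toGroup.of _⟩
  rintro r (⟨i, j, hij, rfl⟩ | ⟨i, j, -, hij, rfl⟩)
  · simp only [map_mul, map_inv, FreeGroup.lift_apply_of]
    rw [braid_rel hA σ hσ hij]
    group
  · simp only [map_mul, map_inv, FreeGroup.lift_apply_of]
    rw [comm_rel hA σ hσ hij]
    group
end
end
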